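/- Let q ∈ (1,2]. There exists a constant c_q > 0, depending only on q, such that for every summable f : ℤ → ℝ with f ≥ 0, ‖H_q(f)‖_q ≤ c_q ‖f‖_q, where H_q(f)(x) = (∫₀^∞ Γ_q(P_t f)(x) dt)^{1/2}. -/

import Mathlib

open MeasureTheory Real

/-- The kernel `K_s` of the fractional discrete Laplacian on `ℤ`. -/
noncomputable def Ker (s : ℝ) (m : ℤ) : ℝ :=
  if m = 0 then 0
  else ((4 : ℝ) ^ s * Real.Gamma (1 / 2 + s) / (Real.sqrt Real.pi * |Real.Gamma (-s)|)) *
    (Real.Gamma ((m.natAbs : ℝ) - s) / Real.Gamma ((m.natAbs : ℝ) + 1 + s))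

/-- The fractional discrete Laplacian `L = (-Δ)^s` acting pointwise. -/
noncomputable def Lop (s : ℝ) (f : ℤ → ℝ) : ℤ → ℝ :=
  fun x => ∑' y : ℤ, (f x - f y) * Ker s (x - y)

/-- The heat semigroup `P_t = exp (-t L)`, given by the exponential series of the
bounded operator `-tL` (evaluated pointwise). -/
noncomputable def heat (s t : ℝ) (f : ℤ → ℝ) : ℤ → ℝ :=
  fun x => ∑' n : ℕ, ((-t) ^ n / (n.factorial : ℝ)) * ((Lop s)^[n] f x)

/-- The squared modulus of the gradient, `|∇f|²(x) = Σ_y K_s(y-x) (f x - f y)²`. -/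
noncomputable def gradSq (s : ℝ) (f : ℤ → ℝ) (x : ℤ) : ℝ :=
  ∑' y : ℤ, Ker s (y - x) * (f x - f y) ^ 2

/-- The squared modulus of the modified gradient,
`|∇̃f|²(x) = Σ_{y : |f y| < |f x|} K_s(y-x) (f x - f y)²`. -/
noncomputable def mgradSq (s : ℝ) (f : ℤ → ℝ) (x : ℤ) : ℝ :=
  ∑' y : {y : ℤ // |f y| < |f x|}, Ker s ((y : ℤ) - x) * (f x - f (y : ℤ)) ^ 2

/-- The `ℓ^q` norm on `ℤ` with counting measure (for finite `q`). -/
noncomputable def lqNorm (q : ℝ) (f : ℤ → ℝ) : ℝ :=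
  (∑' x : ℤ, |f x| ^ q) ^ (1 / q)

/-- The pseudo-gradient `Γ_q(f) = q f · L f - f^{2-q} · L (f^q)` (real powers). -/
noncomputable def GammaQ (s q : ℝ) (f : ℤ → ℝ) : ℤ → ℝ :=
  fun x => q * f x * Lop s f x - f x ^ (2 - q) * Lop s (fun y => f y ^ q) x

section Kernel

variable {s : ℝ}

theorem Ker_neg (m : ℤ) : Ker s (-m) = Ker s m := by
  simp [Ker]

theorem Ker_natCast {n : ℕ} (hn : n ≠ 0) :
    Ker s n = ((4 : ℝ) ^ s * Real.Gamma (1 / 2 + s) / (Real.sqrt Real.pi * |Real.Gamma (-s)|)) *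
      (Real.Gamma ((n : ℝ) - s) / Real.Gamma ((n : ℝ) + 1 + s)) := by
  simp [Ker, hn]

theorem Ker_const_nonneg (hs : s ∈ Set.Ioo (0 : ℝ) 1) :
    0 ≤ (4 : ℝ) ^ s * Real.Gamma (1 / 2 + s) / (Real.sqrt Real.pi * |Real.Gamma (-s)|) := by
  have := Real.Gamma_pos_of_pos (show 0 < 1 / 2 + s by linarith [hs.1])
  positivity

theorem Gamma_ratio_nonneg (hs : s ∈ Set.Ioo (0 : ℝ) 1) (n : ℕ) :
    0 ≤ Real.Gamma (((n + 1 : ℕ) : ℝ) - s) / Real.Gamma (((n + 1 : ℕ) : ℝ) + 1 + s) := by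
  have hn : (0 : ℝ) ≤ n := n.cast_nonneg
  push_cast
  exact div_nonneg (Real.Gamma_pos_of_pos (by linarith [hs.2])).le
    (Real.Gamma_pos_of_pos (by linarith [hs.1])).le

theorem Ker_succ_nonneg (hs : s ∈ Set.Ioo (0 : ℝ) 1) (n : ℕ) : 0 ≤ Ker s (n + 1 : ℕ) := by
  rw [Ker_natCast n.succ_ne_zero]
  exact mul_nonneg (Ker_const_nonneg hs) (Gamma_ratio_nonneg hs n)

theorem Ker_succ_antitone (hs : s ∈ Set.Ioo (0 : ℝ) 1) :
    Antitone fun n : ℕ => Ker s (n + 1 : ℕ) := by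
  refine antitone_nat_of_succ_le fun n => ?_
  simp only [Ker_natCast (Nat.succ_ne_zero _)]
  refine mul_le_mul_of_nonneg_left ?_ (Ker_const_nonneg hs)
  have h1 := hs.1
  have h2 := hs.2
  have hn : (0 : ℝ) ≤ n := n.cast_nonneg
  have e1 : Real.Gamma (((n + 1 + 1 : ℕ) : ℝ) - s) =
      ((n : ℝ) + 1 - s) * Real.Gamma (((n + 1 : ℕ) : ℝ) - s) := by
    push_cast
    rw [← Real.Gamma_add_one (by linarith)]
    ring_nf
  have e2 : Real.Gamma (((n + 1 + 1 : ℕ) : ℝ) + 1 + s) =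
      ((n : ℝ) + 1 + 1 + s) * Real.Gamma (((n + 1 : ℕ) : ℝ) + 1 + s) := by
    push_cast
    rw [← Real.Gamma_add_one (by linarith)]
    ring_nf
  rw [e1, e2, mul_div_mul_comm]
  exact mul_le_of_le_one_left (Gamma_ratio_nonneg hs n)
    ((div_le_one (by linarith)).2 (by linarith))

theorem Ker_succ_summable (hs : s ∈ Set.Ioo (0 : ℝ) 1) :
    Summable fun n : ℕ => Ker s (n + 1 : ℕ) := by
  simp only [Ker_natCast (Nat.succ_ne_zero _)]
  refine Summable.mul_left _ ?_
  have h1 := hs.1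
  have h2 := hs.2
  set b : ℕ → ℝ := fun n => Real.Gamma ((n : ℝ) + 1 - s) / Real.Gamma ((n : ℝ) + 1 + s) with hb
  have hbn : ∀ n, 0 ≤ b n := fun n => by
    have hn : (0 : ℝ) ≤ n := n.cast_nonneg
    exact div_nonneg (Real.Gamma_pos_of_pos (by linarith)).le
      (Real.Gamma_pos_of_pos (by linarith)).le
  have key : ∀ n : ℕ, Real.Gamma (((n + 1 : ℕ) : ℝ) - s) / Real.Gamma (((n + 1 : ℕ) : ℝ) + 1 + s) =
      (b n - b (n + 1)) / (2 * s) := by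
    intro n
    have hn : (0 : ℝ) ≤ n := n.cast_nonneg
    have e1 : Real.Gamma (((n + 1 : ℕ) : ℝ) + 1 - s) =
        ((n : ℝ) + 1 - s) * Real.Gamma ((n : ℝ) + 1 - s) := by
      push_cast
      rw [← Real.Gamma_add_one (by linarith)]
      ring_nf
    have e2 : Real.Gamma (((n + 1 : ℕ) : ℝ) + 1 + s) =
        ((n : ℝ) + 1 + s) * Real.Gamma ((n : ℝ) + 1 + s) := by
      push_cast
      rw [← Real.Gamma_add_one (by linarith)]
      ring_nf
    have hG := (Real.Gamma_pos_of_pos (show 0 < (n : ℝ) + 1 + s by linarith)).ne'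
    have hs0 : s ≠ 0 := h1.ne'
    have hns : (n : ℝ) + 1 + s ≠ 0 := by linarith
    simp only [hb]
    rw [e1, e2]
    push_cast
    field_simp
    ring
  refine summable_of_sum_range_le (c := b 0 / (2 * s)) (Gamma_ratio_nonneg hs) fun n => ?_
  simp only [key]
  rw [← Finset.sum_div, Finset.sum_range_sub']
  gcongr
  linarith [hbn n]

/-- The kernel `Ker s` with its value at the origin replaced by `Ker s 1`. -/
noncomputable def uniKer (s : ℝ) (m : ℤ) : ℝ := if m = 0 then Ker s 1 else Ker s m

theorem uniKer_eq_natAbs (m : ℤ) : uniKer s m = Ker s (m.natAbs - 1 + 1 : ℕ) := by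
  by_cases h : m = 0
  · simp [uniKer, h]
  · have : m.natAbs - 1 + 1 = m.natAbs := Nat.sub_add_cancel (Int.natAbs_pos.2 h)
    rw [uniKer, if_neg h, this]
    simp [Ker]

theorem uniKer_nonneg (hs : s ∈ Set.Ioo (0 : ℝ) 1) (m : ℤ) : 0 ≤ uniKer s m := by
  rw [uniKer_eq_natAbs]
  exact Ker_succ_nonneg hs _

theorem uniKer_le (hs : s ∈ Set.Ioo (0 : ℝ) 1) {x y : ℤ} (h : |x| ≤ |y|) :
    uniKer s y ≤ uniKer s x := by
  rw [uniKer_eq_natAbs, uniKer_eq_natAbs]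
  exact Ker_succ_antitone hs (Nat.sub_le_sub_right (by
    rw [Int.abs_eq_natAbs, Int.abs_eq_natAbs] at h
    exact_mod_cast h) 1)

theorem uniKer_summable (hs : s ∈ Set.Ioo (0 : ℝ) 1) : Summable (uniKer s) := by
  have h : Summable fun n : ℕ => uniKer s n := by
    rw [← summable_nat_add_iff 1]
    refine (Ker_succ_summable hs).congr fun n => ?_
    rw [uniKer_eq_natAbs, Int.natAbs_natCast, Nat.add_sub_cancel]
  refine Summable.of_nat_of_neg h (h.congr fun n => ?_)
  simp [uniKer_eq_natAbs]

end Kernel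

section Maximal

open scoped ENNReal

/-- The one-sided covering argument behind the weak-type estimate on `ℤ`. -/
theorem card_mul_le_tsum_of_averages (F : ℤ → ℝ≥0∞) (c : ℝ≥0∞) (E : Finset ℤ)
    (hE : ∀ x ∈ E, ∃ n : ℕ, 0 < n ∧ n * c ≤ ∑ i ∈ Finset.range n, F (x + i)) :
    (E.card : ℝ≥0∞) * c ≤ ∑' x, F x := by
  suffices H : ∀ (N : ℕ) (E : Finset ℤ), E.card ≤ N →
      (∀ x ∈ E, ∃ n : ℕ, 0 < n ∧ n * c ≤ ∑ i ∈ Finset.range n, F (x + i)) →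
      ∀ a : ℤ, (∀ x ∈ E, a ≤ x) → (E.card : ℝ≥0∞) * c ≤ ∑' x, (Set.Ici a).indicator F x by
    obtain ⟨a, ha⟩ := E.bddBelow
    refine (H _ E le_rfl hE a fun x hx => ha hx).trans (ENNReal.tsum_le_tsum fun x => ?_)
    exact Set.indicator_le_self _ _ _
  intro N
  induction N with
  | zero =>
    intro E hN _ a _
    simp [Finset.card_eq_zero.1 (Nat.le_zero.1 hN)]
  | succ N ih =>
    intro E hN hE a ha
    rcases E.eq_empty_or_nonempty with rfl | hne
    · simp
    set x := E.min' hne with hx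
    have hxE : x ∈ E := E.min'_mem hne
    obtain ⟨n, hn, hnc⟩ := hE x hxE
    set E₂ := E.filter (x + n ≤ ·) with hE₂
    have hsub : E \ E₂ ⊆ Finset.Ico x (x + n) := by
      intro y hy
      rw [Finset.mem_sdiff, hE₂, Finset.mem_filter] at hy
      have := E.min'_le y hy.1
      rw [Finset.mem_Ico]
      refine ⟨this, ?_⟩
      by_contra hc
      exact hy.2 ⟨hy.1, not_lt.1 hc⟩
    have hcard : (E \ E₂).card ≤ n := by
      simpa using Finset.card_le_card hsub
    have hsplit : (E \ E₂).card + E₂.card = E.card :=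
      Finset.card_sdiff_add_card_eq_card (Finset.filter_subset _ _)
    have hx₂ : x ∉ E₂ := by
      simp [hE₂, hn.ne']
    have hlt : E₂.card < E.card := Finset.card_lt_card
      ⟨Finset.filter_subset _ _, fun h => hx₂ (h hxE)⟩
    have hrec := ih E₂ (by omega) (fun y hy => hE y (Finset.mem_filter.1 hy).1) (x + n)
      (fun y hy => (Finset.mem_filter.1 hy).2)
    have hsum : ∑ i ∈ Finset.range n, F (x + i) = ∑' y, (Set.Ico x (x + n)).indicator F y := by
      rw [← Finset.coe_Ico, ← sum_eq_tsum_indicator]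
      symm
      refine Finset.sum_bij' (fun y _ => (y - x).toNat) (fun i _ => x + i) ?_ ?_ ?_ ?_ ?_ <;>
        intro y hy <;> simp only [Finset.mem_Ico, Finset.mem_range] at * <;> try omega
      congr 1
      omega
    calc (E.card : ℝ≥0∞) * c = (E \ E₂).card * c + E₂.card * c := by
          rw [← add_mul, ← Nat.cast_add, hsplit]
      _ ≤ n * c + E₂.card * c := by gcongr
      _ ≤ ∑' y, (Set.Ico x (x + n)).indicator F y + ∑' y, (Set.Ici (x + n : ℤ)).indicator F y := by
          rw [← hsum]
          exact add_le_add hnc hrec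
      _ = ∑' y, ((Set.Ico x (x + n)).indicator F y + (Set.Ici (x + n : ℤ)).indicator F y) :=
          ENNReal.tsum_add.symm
      _ ≤ _ := by
          refine ENNReal.tsum_le_tsum fun y => ?_
          have := ha x hxE
          simp only [Set.indicator_apply, Set.mem_Ico, Set.mem_Ici]
          split_ifs <;> first | omega | simp

end Maximal

section MaximalFunction

open scoped ENNReal

/-- The one-sided Hardy–Littlewood maximal function on `ℤ`. -/
noncomputable def maxAvg (f : ℤ → ℝ) (x : ℤ) : ℝ :=
  ⨆ n : ℕ, (∑ i ∈ Finset.range (n + 1), f (x + i)) / (n + 1)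

theorem sum_range_le_tsum {f : ℤ → ℝ} (hf : Summable f) (h0 : ∀ x, 0 ≤ f x) (x : ℤ) (n : ℕ) :
    ∑ i ∈ Finset.range n, f (x + i) ≤ ∑' y, f y := by
  have hinj : Function.Injective fun i : ℕ => x + (i : ℤ) := fun a b h => by simpa using h
  rw [← Finset.sum_image (f := f) (s := Finset.range n) (g := fun i : ℕ => x + (i : ℤ))
    fun a _ b _ h => hinj h]
  exact hf.sum_le_tsum _ fun y _ => h0 y

theorem maxAvg_bddAbove {f : ℤ → ℝ} (hf : Summable f) (h0 : ∀ x, 0 ≤ f x) (x : ℤ) :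
    BddAbove (Set.range fun n : ℕ => (∑ i ∈ Finset.range (n + 1), f (x + i)) / ((n : ℝ) + 1)) := by
  refine ⟨∑' y, f y, ?_⟩
  rintro _ ⟨n, rfl⟩
  refine (div_le_self (Finset.sum_nonneg fun i _ => h0 _) ?_).trans
    (sum_range_le_tsum hf h0 x (n + 1))
  linarith [(n.cast_nonneg : (0 : ℝ) ≤ n)]

theorem sum_range_le_mul_maxAvg {f : ℤ → ℝ} (hf : Summable f) (h0 : ∀ x, 0 ≤ f x) (x : ℤ) (n : ℕ) :
    ∑ i ∈ Finset.range n, f (x + i) ≤ n * maxAvg f x := by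
  rcases n with _ | n
  · simp
  have h := le_ciSup (maxAvg_bddAbove hf h0 x) n
  have hn : (0 : ℝ) < n + 1 := by positivity
  rw [div_le_iff₀ hn] at h
  push_cast
  rw [mul_comm]
  exact h

theorem maxAvg_nonneg {f : ℤ → ℝ} (h0 : ∀ x, 0 ≤ f x) (x : ℤ) : 0 ≤ maxAvg f x :=
  Real.iSup_nonneg fun _ => div_nonneg (Finset.sum_nonneg fun _ _ => h0 _) (by positivity)

theorem count_maxAvg_gt_mul_le {f : ℤ → ℝ} (h0 : ∀ x, 0 ≤ f x) {t : ℝ}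
    (ht : 0 < t) :
    Measure.count {x | t < maxAvg f x} * ENNReal.ofReal (t / 2) ≤
      ∑' x, ENNReal.ofReal (if t < 2 * f x then f x else 0) := by
  rw [← lintegral_indicator_one (MeasurableSet.of_discrete), lintegral_count,
    ← ENNReal.tsum_mul_right, ENNReal.tsum_eq_iSup_sum]
  refine iSup_le fun E => ?_
  rw [← Finset.sum_mul]
  classical
  have hcard : ∑ x ∈ E, ({x | t < maxAvg f x}.indicator 1 x : ℝ≥0∞) =
      (E.filter fun x => t < maxAvg f x).card := by
    simp [Set.indicator_apply]
  rw [hcard]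
  refine card_mul_le_tsum_of_averages _ _ _ fun x hx => ?_
  obtain ⟨n, hn⟩ := exists_lt_of_lt_ciSup (Finset.mem_filter.1 hx).2
  refine ⟨n + 1, n.succ_pos, ?_⟩
  rw [lt_div_iff₀ (by positivity)] at hn
  rw [← ENNReal.ofReal_sum_of_nonneg, ← ENNReal.ofReal_natCast,
    ← ENNReal.ofReal_mul (Nat.cast_nonneg _)]
  · refine ENNReal.ofReal_le_ofReal ?_
    have : ∑ i ∈ Finset.range (n + 1), f (x + i) ≤
        ∑ i ∈ Finset.range (n + 1), ((if t < 2 * f (x + i) then f (x + i) else 0) + t / 2) := by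
      refine Finset.sum_le_sum fun i _ => ?_
      split_ifs <;> linarith
    rw [Finset.sum_add_distrib, Finset.sum_const, Finset.card_range, nsmul_eq_mul] at this
    push_cast at this ⊢
    linarith
  · intro i _
    split_ifs
    exacts [h0 _, le_rfl]

theorem lintegral_rpow_truncation {q : ℝ} (hq : 1 < q) {a : ℝ} (ha : 0 ≤ a) :
    ∫⁻ t in Set.Ioi (0 : ℝ), ENNReal.ofReal (if t < 2 * a then a else 0) *
      ENNReal.ofReal (2 * t ^ (q - 2)) = ENNReal.ofReal (2 ^ q / (q - 1)) * ENNReal.ofReal (a ^ q) := by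
  have hint : IntervalIntegrable (fun t : ℝ => a * (2 * t ^ (q - 2))) volume 0 (2 * a) :=
    ((intervalIntegral.intervalIntegrable_rpow' (by linarith)).const_mul 2).const_mul a
  have h2a : 0 ≤ 2 * a := by linarith
  have h1 : ∀ t ∈ Set.Ioi (0 : ℝ), ENNReal.ofReal (if t < 2 * a then a else 0) *
      ENNReal.ofReal (2 * t ^ (q - 2)) =
      (Set.Iio (2 * a)).indicator (fun t => ENNReal.ofReal (a * (2 * t ^ (q - 2)))) t := by
    intro t _
    by_cases h : t < 2 * a <;> simp [h, ENNReal.ofReal_mul ha]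
  rw [setLIntegral_congr_fun measurableSet_Ioi h1, setLIntegral_indicator measurableSet_Iio,
    Set.inter_comm, Set.Ioi_inter_Iio, setLIntegral_congr Ioo_ae_eq_Ioc,
    ← ofReal_integral_eq_lintegral_ofReal hint.1 ?_, ← intervalIntegral.integral_of_le h2a,
    intervalIntegral.integral_const_mul, intervalIntegral.integral_const_mul,
    integral_rpow (Or.inl (by linarith)), ← ENNReal.ofReal_mul]
  · congr 1
    rw [show q - 2 + 1 = q - 1 by ring, Real.zero_rpow (by linarith), Real.mul_rpow two_pos.le ha,
      show q = (q - 1) + 1 by ring, Real.rpow_add_one two_ne_zero,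
      Real.rpow_add_one' ha (by linarith)]
    simp only [add_sub_cancel_right]
    ring
  · exact div_nonneg (by positivity) (by linarith)
  · refine (ae_restrict_iff' measurableSet_Ioc).2 (ae_of_all _ fun t ht => ?_)
    exact mul_nonneg ha (mul_nonneg two_pos.le (Real.rpow_nonneg ht.1.le _))

theorem tsum_maxAvg_rpow_le {q : ℝ} (hq : 1 < q) {f : ℤ → ℝ}
    (h0 : ∀ x, 0 ≤ f x) :
    ∑' x, ENNReal.ofReal (maxAvg f x ^ q) ≤
      ENNReal.ofReal q * ENNReal.ofReal (2 ^ q / (q - 1)) * ∑' x, ENNReal.ofReal (f x ^ q) := by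
  rw [← lintegral_count, lintegral_rpow_eq_lintegral_meas_lt_mul _
    (ae_of_all _ (maxAvg_nonneg h0)) (measurable_of_countable _).aemeasurable (by linarith),
    mul_assoc, ← ENNReal.tsum_mul_left]
  gcongr
  calc ∫⁻ t in Set.Ioi (0 : ℝ), Measure.count {x | t < maxAvg f x} * ENNReal.ofReal (t ^ (q - 1))
      ≤ ∫⁻ t in Set.Ioi (0 : ℝ), ∑' x, ENNReal.ofReal (if t < 2 * f x then f x else 0) *
          ENNReal.ofReal (2 * t ^ (q - 2)) := by
        refine setLIntegral_mono' measurableSet_Ioi fun t ht => ?_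
        rw [Set.mem_Ioi] at ht
        rw [ENNReal.tsum_mul_right]
        refine le_trans (le_of_eq ?_) (mul_le_mul_left (count_maxAvg_gt_mul_le h0 ht) _)
        rw [mul_assoc, ← ENNReal.ofReal_mul (by positivity)]
        congr 2
        rw [show q - 1 = (q - 2) + 1 by ring, Real.rpow_add_one ht.ne']
        ring
    _ = ∑' x, ∫⁻ t in Set.Ioi (0 : ℝ), ENNReal.ofReal (if t < 2 * f x then f x else 0) *
          ENNReal.ofReal (2 * t ^ (q - 2)) := by
        refine lintegral_tsum fun x => ?_
        have h₁ : Measurable fun t : ℝ => if t < 2 * f x then f x else 0 :=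
          Measurable.ite measurableSet_Iio measurable_const measurable_const
        have h₂ : Measurable fun t : ℝ => 2 * t ^ (q - 2) :=
          (measurable_id.pow_const _).const_mul 2
        exact (h₁.ennreal_ofReal.mul h₂.ennreal_ofReal).aemeasurable
    _ = _ := tsum_congr fun x => lintegral_rpow_truncation hq (h0 x)

end MaximalFunction

section UnimodalKernels

open scoped ENNReal NNReal

theorem sum_mul_le_of_antitone {k F : ℕ → ℝ} {m : ℝ} (hk : Antitone k) (hk0 : ∀ n, 0 ≤ k n)
    (hF : ∀ n : ℕ, ∑ i ∈ Finset.range n, F i ≤ n * m) (n : ℕ) :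
    ∑ i ∈ Finset.range n, k i * F i ≤ (∑ i ∈ Finset.range n, k i) * m := by
  suffices H : ∑ i ∈ Finset.range n, k i * F i + k n * (n * m) ≤
      (∑ i ∈ Finset.range n, k i) * m + k n * ∑ i ∈ Finset.range n, F i by
    nlinarith [mul_le_mul_of_nonneg_left (hF n) (hk0 n)]
  induction n with
  | zero => simp
  | succ n ih =>
    have h := mul_le_mul_of_nonneg_left (hF (n + 1)) (sub_nonneg.2 (hk n.le_succ))
    simp only [Finset.sum_range_succ] at h ⊢
    push_cast at h ⊢
    linarith

theorem tsum_mul_le_of_antitone {k F : ℕ → ℝ≥0∞} {m : ℝ≥0∞} (hk : Antitone k) (hk0 : k 0 ≠ ∞)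
    (hm : m ≠ ∞) (hF : ∀ n : ℕ, ∑ i ∈ Finset.range n, F i ≤ n * m) :
    ∑' i, k i * F i ≤ (∑' i, k i) * m := by
  have hkf : ∀ n, k n ≠ ∞ := fun n => ne_top_of_le_ne_top hk0 (hk n.zero_le)
  have hFf : ∀ n, F n ≠ ∞ := fun n => by
    refine ne_top_of_le_ne_top (ENNReal.mul_ne_top (ENNReal.natCast_ne_top (n + 1)) hm)
      (le_trans ?_ (hF (n + 1)))
    exact Finset.single_le_sum (f := F) (fun _ _ => zero_le) (Finset.self_mem_range_succ n)
  lift k to ℕ → ℝ≥0 using hkf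
  lift F to ℕ → ℝ≥0 using hFf
  lift m to ℝ≥0 using hm
  rw [ENNReal.tsum_eq_iSup_nat]
  refine iSup_le fun n => le_trans ?_
    (mul_le_mul_left (ENNReal.sum_le_tsum (Finset.range n)) _)
  have hk' : Antitone k := fun a b h => ENNReal.coe_le_coe.1 (hk h)
  have hF' : ∀ n : ℕ, ∑ i ∈ Finset.range n, F i ≤ n * m := fun n => by
    have := hF n
    simp only at this
    exact_mod_cast this
  have h := sum_mul_le_of_antitone (k := fun n => k n) (F := fun n => F n) (m := m)
    (fun a b h => NNReal.coe_le_coe.2 (hk' h)) (fun n => (k n).2)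
    (fun n => by exact_mod_cast hF' n) n
  have h' : ∑ i ∈ Finset.range n, k i * F i ≤ (∑ i ∈ Finset.range n, k i) * m := by
    exact_mod_cast h
  simp only
  exact_mod_cast h'

/-- Nonnegative sequences on `ℤ` that are even and non-increasing in `|x|`. -/
def SymmUnimodal (k : ℤ → ℝ≥0∞) : Prop := ∀ x y : ℤ, |x| ≤ |y| → k y ≤ k x

/-- Convolution of nonnegative sequences on `ℤ`. -/
noncomputable def conv (k j : ℤ → ℝ≥0∞) (w : ℤ) : ℝ≥0∞ := ∑' z, k z * j (w - z)

/-- The weighted sum of the translates of `F` with weights `k`. -/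
noncomputable def wavg (k F : ℤ → ℝ≥0∞) (x : ℤ) : ℝ≥0∞ := ∑' z, k z * F (x + z)

theorem SymmUnimodal.neg {k : ℤ → ℝ≥0∞} (hk : SymmUnimodal k) (x : ℤ) : k (-x) = k x :=
  le_antisymm (hk _ _ (by simp)) (hk _ _ (by simp))

theorem mul_add_mul_le_of_le {a a' b b' : ℝ≥0∞} (ha : a' ≤ a) (hb : b' ≤ b) :
    a * b' + a' * b ≤ a * b + a' * b' := by
  obtain ⟨d, rfl⟩ := le_iff_exists_add.1 ha
  calc (a' + d) * b' + a' * b = (a' * b + a' * b') + d * b' := by ring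
    _ ≤ (a' * b + a' * b') + d * b := by gcongr
    _ = _ := by ring

theorem SymmUnimodal.conv {k j : ℤ → ℝ≥0∞} (hk : SymmUnimodal k) (hj : SymmUnimodal j) :
    SymmUnimodal (conv k j) := by
  have heven : ∀ w, _root_.conv k j (-w) = _root_.conv k j w := fun w => by
    rw [_root_.conv, ← (Equiv.neg ℤ).tsum_eq]
    refine tsum_congr fun z => ?_
    simp only [Equiv.neg_apply]
    rw [hk.neg, show -w - -z = -(w - z) by ring, hj.neg]
  have hstep : ∀ n : ℕ, _root_.conv k j (n + 1 : ℕ) ≤ _root_.conv k j n := by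
    intro n
    have hrefl : ∀ w, _root_.conv k j w =
        ∑' y : ℤ, k (2 * n + 1 - y) * j (w - (2 * n + 1 - y)) := fun w =>
      ((Equiv.subLeft (2 * (n : ℤ) + 1)).tsum_eq fun y => k y * j (w - y)).symm
    have h2 : ∀ w, 2 * _root_.conv k j w =
        ∑' y : ℤ, (k y * j (w - y) + k (2 * n + 1 - y) * j (w - (2 * n + 1 - y))) := fun w => by
      rw [ENNReal.tsum_add, ← hrefl, two_mul]
      rfl
    rw [← ENNReal.mul_le_mul_iff_right two_ne_zero ENNReal.ofNat_ne_top, h2, h2]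
    refine ENNReal.tsum_le_tsum fun y => ?_
    have e1 : j ((n : ℤ) - (2 * n + 1 - y)) = j ((n + 1 : ℕ) - y) := by
      rw [← hj.neg]
      congr 1
      push_cast
      ring
    have e2 : j ((n + 1 : ℕ) - (2 * n + 1 - y)) = j ((n : ℤ) - y) := by
      rw [← hj.neg]
      congr 1
      push_cast
      ring
    rw [e1, e2]
    rcases le_or_gt y n with hy | hy
    · refine mul_add_mul_le_of_le (hk _ _ ?_) (hj _ _ ?_)
      · rw [abs_of_nonneg (a := 2 * (n : ℤ) + 1 - y) (by omega), abs_le]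
        omega
      · push_cast
        rw [abs_of_nonneg (by omega), abs_of_nonneg (by omega)]
        omega
    · have := mul_add_mul_le_of_le (a := k (2 * n + 1 - y)) (a' := k y)
        (b := j ((n + 1 : ℕ) - y)) (b' := j (n - y)) (hk _ _ ?_) (hj _ _ ?_)
      · rw [add_comm, add_comm (k y * j (n - y))]
        exact this
      · rw [abs_of_nonneg (a := y) (by omega), abs_le]
        omega
      · push_cast
        rw [abs_of_nonpos (by omega), abs_of_nonpos (by omega)]
        omega
  have hanti : Antitone fun n : ℕ => _root_.conv k j n := antitone_nat_of_succ_le hstep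
  have habs : ∀ x : ℤ, _root_.conv k j x = _root_.conv k j (x.natAbs : ℕ) := fun x => by
    rcases Int.natAbs_eq x with h | h
    · rw [← h]
    · conv_lhs => rw [h]
      exact heven _
  intro x y hxy
  rw [habs x, habs y]
  refine hanti ?_
  rw [Int.abs_eq_natAbs, Int.abs_eq_natAbs] at hxy
  exact_mod_cast hxy

theorem symmUnimodal_single : SymmUnimodal (Pi.single 0 1) := by
  intro x y hxy
  by_cases hy : y = 0
  · subst hy
    rw [abs_zero, abs_nonpos_iff] at hxy
    rw [hxy]
  · rw [Pi.single_eq_of_ne hy]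
    exact zero_le

theorem tsum_conv (k j : ℤ → ℝ≥0∞) : ∑' w, conv k j w = (∑' z, k z) * ∑' z, j z := by
  simp only [conv]
  rw [ENNReal.tsum_comm, ← ENNReal.tsum_mul_right]
  refine tsum_congr fun z => ?_
  rw [ENNReal.tsum_mul_left, ← (Equiv.subRight z).tsum_eq j]
  rfl

theorem wavg_wavg (k j F : ℤ → ℝ≥0∞) (x : ℤ) : wavg k (wavg j F) x = wavg (conv k j) F x := by
  simp only [wavg, conv, ← ENNReal.tsum_mul_left, ← ENNReal.tsum_mul_right]
  rw [ENNReal.tsum_comm (f := fun w z => k z * j (w - z) * F (x + w))]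
  refine tsum_congr fun z => ?_
  rw [← (Equiv.subRight z).tsum_eq]
  refine tsum_congr fun w => ?_
  simp only [Equiv.subRight_apply]
  rw [mul_assoc, show x + z + (w - z) = x + w by ring]

theorem tsum_wavg (k F : ℤ → ℝ≥0∞) : ∑' x, wavg k F x = (∑' z, k z) * ∑' x, F x := by
  simp only [wavg]
  rw [ENNReal.tsum_comm, ← ENNReal.tsum_mul_right]
  refine tsum_congr fun z => ?_
  rw [ENNReal.tsum_mul_left, ← (Equiv.addRight z).tsum_eq F]
  rfl

theorem SymmUnimodal.wavg_le {k F : ℤ → ℝ≥0∞} (hk : SymmUnimodal k) (hk0 : k 0 ≠ ∞) {x : ℤ}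
    {m₁ m₂ : ℝ≥0∞} (hm₁ : m₁ ≠ ∞) (hm₂ : m₂ ≠ ∞)
    (h₁ : ∀ n : ℕ, ∑ i ∈ Finset.range n, F (x + i) ≤ n * m₁)
    (h₂ : ∀ n : ℕ, ∑ i ∈ Finset.range n, F (x - i) ≤ n * m₂) :
    wavg k F x ≤ (∑' z, k z) * (m₁ + m₂) := by
  have hanti : Antitone fun n : ℕ => k n := fun a b h => hk _ _ (by simpa using h)
  have hle : ∑' n : ℕ, k n ≤ ∑' z, k z :=
    ENNReal.tsum_comp_le_tsum_of_injective Nat.cast_injective _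
  calc wavg k F x = ∑' n : ℕ, k n * F (x + n) + ∑' n : ℕ, k (-(n + 1)) * F (x + -(n + 1)) :=
        tsum_of_nat_of_neg_add_one ENNReal.summable ENNReal.summable
    _ ≤ ∑' n : ℕ, k n * F (x + n) + ∑' n : ℕ, k n * F (x - n) := by
        refine add_le_add le_rfl ?_
        refine le_trans (le_of_eq ?_) (ENNReal.tsum_comp_le_tsum_of_injective
          (add_left_injective 1) fun n : ℕ => k n * F (x - n))
        refine tsum_congr fun n => ?_
        rw [hk.neg]
        push_cast
        rfl
    _ ≤ (∑' n : ℕ, k n) * m₁ + (∑' n : ℕ, k n) * m₂ :=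
        add_le_add (tsum_mul_le_of_antitone hanti hk0 hm₁ h₁)
          (tsum_mul_le_of_antitone hanti hk0 hm₂ h₂)
    _ ≤ (∑' z, k z) * (m₁ + m₂) := by
        rw [← mul_add]
        gcongr

end UnimodalKernels

section Semigroup

open scoped ENNReal

theorem hasSum_exp_smul_apply {E : Type*} [NormedAddCommGroup E] [NormedSpace ℝ E]
    [CompleteSpace E] (T : E →L[ℝ] E) (t : ℝ) (g : E) (φ : E →L[ℝ] ℝ) :
    HasSum (fun n : ℕ => t ^ n / (n.factorial : ℝ) * φ ((T ^ n) g))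
      (φ (NormedSpace.exp (t • T) g)) := by
  have h := NormedSpace.exp_series_hasSum_exp' (𝕂 := ℝ) (t • T)
  refine ((h.mapL (ContinuousLinearMap.apply ℝ E g)).mapL φ).congr_fun fun n => ?_
  rw [smul_pow, smul_smul, div_eq_inv_mul, map_smul, map_smul]
  rfl

/-- The Banach space of bounded real sequences on `ℤ`. -/
abbrev BddSeq := lp (fun _ : ℤ => ℝ) ∞

theorem BddSeq.abs_apply_le (g : BddSeq) (x : ℤ) : |g x| ≤ ‖g‖ :=
  lp.norm_apply_le_norm ENNReal.top_ne_zero g x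

/-- The element of `BddSeq` given by a bounded function. -/
def BddSeq.mk (g : ℤ → ℝ) (C : ℝ) (h : ∀ x, |g x| ≤ C) : BddSeq :=
  ⟨g, memℓp_infty ⟨C, by rintro _ ⟨x, rfl⟩; exact h x⟩⟩

variable {a : ℤ → ℝ} (ha : Summable a)

theorem norm_mul_shift_le (a : ℤ → ℝ) (g : BddSeq) (x z : ℤ) :
    ‖a z * g (x + z)‖ ≤ ‖a z‖ * ‖g‖ := by
  rw [norm_mul]
  exact mul_le_mul_of_nonneg_left (BddSeq.abs_apply_le g _) (norm_nonneg _)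

include ha in
theorem summable_mul_shift (g : BddSeq) (x : ℤ) : Summable fun z => a z * g (x + z) :=
  Summable.of_norm_bounded (ha.norm.mul_right ‖g‖) (norm_mul_shift_le a g x)

include ha in
theorem abs_tsum_mul_shift_le (g : BddSeq) (x : ℤ) :
    |∑' z, a z * g (x + z)| ≤ (∑' z, ‖a z‖) * ‖g‖ := by
  rw [← tsum_mul_right]
  exact tsum_of_norm_bounded (ha.norm.mul_right ‖g‖).hasSum (norm_mul_shift_le a g x)

/-- The operator `g ↦ ∑ z, a z * g (· + z)` on bounded sequences. -/
noncomputable def avgOp : BddSeq →L[ℝ] BddSeq :=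
  LinearMap.mkContinuous
    { toFun := fun g => BddSeq.mk (fun x => ∑' z, a z * g (x + z)) ((∑' z, ‖a z‖) * ‖g‖)
        (abs_tsum_mul_shift_le ha g)
      map_add' := fun g h => by
        ext x
        simp only [BddSeq.mk, lp.coeFn_add, Pi.add_apply, mul_add]
        exact (summable_mul_shift ha g x).tsum_add (summable_mul_shift ha h x)
      map_smul' := fun r g => by
        ext x
        simp only [BddSeq.mk, lp.coeFn_smul, Pi.smul_apply, smul_eq_mul, RingHom.id_apply,
          ← tsum_mul_left]
        exact tsum_congr fun z => by ring }
    (∑' z, ‖a z‖) fun g => lp.norm_le_of_forall_le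
      (mul_nonneg (tsum_nonneg fun _ => norm_nonneg _) (norm_nonneg _)) (abs_tsum_mul_shift_le ha g)

theorem avgOp_apply (g : BddSeq) (x : ℤ) : avgOp ha g x = ∑' z, a z * g (x + z) := rfl

/-- The generator `g ↦ ∑ z, a z * (g - g (· + z))` on bounded sequences. -/
noncomputable def genOp : BddSeq →L[ℝ] BddSeq := (∑' z, a z) • 1 - avgOp ha

theorem genOp_apply (g : BddSeq) (x : ℤ) :
    genOp ha g x = (∑' z, a z) * g x - ∑' z, a z * g (x + z) := rfl

/-- The semigroup `exp (-t L)` on bounded sequences, with generator `L = genOp ha`. -/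
noncomputable def semigroup (t : ℝ) : BddSeq →L[ℝ] BddSeq :=
  NormedSpace.exp (t • (-genOp ha))

theorem semigroup_eq (t : ℝ) :
    semigroup ha t = Real.exp (-(t * ∑' z, a z)) • NormedSpace.exp (t • avgOp ha) := by
  let _ : NormedAlgebra ℚ (BddSeq →L[ℝ] BddSeq) := NormedAlgebra.restrictScalars ℚ ℝ _
  have h : t • (-genOp ha) = algebraMap ℝ _ (-(t * ∑' z, a z)) + t • avgOp ha := by
    rw [genOp, Algebra.algebraMap_eq_smul_one]
    module
  rw [semigroup, h, NormedSpace.exp_add_of_commute (Algebra.commutes _ _),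
    ← NormedSpace.algebraMap_exp_comm, ← Algebra.smul_def, Real.exp_eq_exp_ℝ]

theorem hasDerivAt_semigroup (g : BddSeq) (x : ℤ) (t : ℝ) :
    HasDerivAt (fun t => semigroup ha t g x) (-genOp ha (semigroup ha t g) x) t := by
  have h := hasDerivAt_exp_smul_const' (𝕂 := ℝ) (-genOp ha) t
  have h2 := ((lp.evalCLM ℝ (fun _ : ℤ => ℝ) ∞ x).comp
    (ContinuousLinearMap.apply ℝ BddSeq g)).hasFDerivAt.comp_hasDerivAt t h
  exact h2

/-- The kernels of the powers of `avgOp`. -/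
noncomputable def kpow (a : ℤ → ℝ) : ℕ → ℤ → ℝ≥0∞
  | 0 => Pi.single 0 1
  | n + 1 => conv (fun z => ENNReal.ofReal (a z)) (kpow a n)

theorem semigroup_hasSum (t : ℝ) (g : BddSeq) (x : ℤ) :
    HasSum (fun n : ℕ => Real.exp (-(t * ∑' z, a z)) * (t ^ n / (n.factorial : ℝ) *
      (avgOp ha ^ n) g x)) (semigroup ha t g x) := by
  rw [semigroup_eq]
  exact (hasSum_exp_smul_apply (avgOp ha) t g
    (lp.evalCLM ℝ (fun _ : ℤ => ℝ) ∞ x)).mul_left _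

variable (h0 : ∀ z, 0 ≤ a z)
include h0

theorem avgOp_pow_nonneg {g : BddSeq} (hg : ∀ x, 0 ≤ g x) (n : ℕ) (x : ℤ) :
    0 ≤ (avgOp ha ^ n) g x := by
  induction n generalizing x with
  | zero => exact hg x
  | succ n ih =>
    rw [pow_succ', mul_apply_eq_comp, avgOp_apply]
    exact tsum_nonneg fun z => mul_nonneg (h0 z) (ih _)

theorem ofReal_avgOp {g : BddSeq} (hg : ∀ x, 0 ≤ g x) (x : ℤ) :
    ENNReal.ofReal (avgOp ha g x) =
      wavg (fun z => ENNReal.ofReal (a z)) (fun z => ENNReal.ofReal (g z)) x := by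
  rw [avgOp_apply, ENNReal.ofReal_tsum_of_nonneg (fun z => mul_nonneg (h0 z) (hg _))
    (summable_mul_shift ha g x)]
  exact tsum_congr fun z => ENNReal.ofReal_mul (h0 z)

theorem ofReal_avgOp_pow {g : BddSeq} (hg : ∀ x, 0 ≤ g x) (n : ℕ) (x : ℤ) :
    ENNReal.ofReal ((avgOp ha ^ n) g x) = wavg (kpow a n) (fun z => ENNReal.ofReal (g z)) x := by
  induction n generalizing x with
  | zero =>
    rw [wavg, tsum_eq_single 0]
    · simp [kpow]
    · intro z hz
      simp [kpow, hz]
  | succ n ih =>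
    rw [pow_succ', mul_apply_eq_comp,
      ofReal_avgOp ha h0 (avgOp_pow_nonneg ha h0 hg n), kpow, ← wavg_wavg]
    simp only [ih]

theorem semigroup_nonneg {g : BddSeq} (hg : ∀ x, 0 ≤ g x) {t : ℝ} (ht : 0 ≤ t) (x : ℤ) :
    0 ≤ semigroup ha t g x :=
  (semigroup_hasSum ha t g x).nonneg fun n => mul_nonneg (Real.exp_pos _).le
    (mul_nonneg (by positivity) (avgOp_pow_nonneg ha h0 hg n x))

theorem ofReal_semigroup {g : BddSeq} (hg : ∀ x, 0 ≤ g x) {t : ℝ} (ht : 0 ≤ t) (x : ℤ) :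
    ENNReal.ofReal (semigroup ha t g x) =
      ∑' n : ℕ, ENNReal.ofReal (Real.exp (-(t * ∑' z, a z)) * (t ^ n / (n.factorial : ℝ))) *
        wavg (kpow a n) (fun z => ENNReal.ofReal (g z)) x := by
  rw [← (semigroup_hasSum ha t g x).tsum_eq, ENNReal.ofReal_tsum_of_nonneg
    (fun n => mul_nonneg (Real.exp_pos _).le
    (mul_nonneg (by positivity) (avgOp_pow_nonneg ha h0 hg n x)))
    (semigroup_hasSum ha t g x).summable]
  refine tsum_congr fun n => ?_
  rw [← mul_assoc, ENNReal.ofReal_mul (by positivity), ofReal_avgOp_pow ha h0 hg]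

include ha in
theorem tsum_kpow (n : ℕ) : ∑' z, kpow a n z = ENNReal.ofReal (∑' z, a z) ^ n := by
  induction n with
  | zero => simp [kpow]
  | succ n ih => rw [kpow, tsum_conv, ih, pow_succ', ENNReal.ofReal_tsum_of_nonneg h0 ha]

include ha in
theorem tsum_poisson {t : ℝ} (ht : 0 ≤ t) :
    ∑' n : ℕ, ENNReal.ofReal (Real.exp (-(t * ∑' z, a z)) * (t ^ n / (n.factorial : ℝ))) *
      ∑' z, kpow a n z = 1 := by
  have hc : 0 ≤ ∑' z, a z := tsum_nonneg h0
  have hs : HasSum (fun n : ℕ => Real.exp (-(t * ∑' z, a z)) * (t ^ n / (n.factorial : ℝ)) *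
      (∑' z, a z) ^ n) 1 := by
    have h := (NormedSpace.expSeries_div_hasSum_exp (t * ∑' z, a z)).mul_left
      (Real.exp (-(t * ∑' z, a z)))
    rw [← Real.exp_eq_exp_ℝ, ← Real.exp_add, neg_add_cancel, Real.exp_zero] at h
    refine h.congr_fun fun n => ?_
    rw [mul_pow]
    ring
  rw [← ENNReal.ofReal_one, ← hs.tsum_eq, ENNReal.ofReal_tsum_of_nonneg (fun n => by positivity)
    hs.summable]
  refine tsum_congr fun n => ?_
  rw [tsum_kpow ha h0, ← ENNReal.ofReal_pow hc, ← ENNReal.ofReal_mul (by positivity)]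

theorem tsum_ofReal_semigroup {g : BddSeq} (hg : ∀ x, 0 ≤ g x) {t : ℝ} (ht : 0 ≤ t) :
    ∑' x, ENNReal.ofReal (semigroup ha t g x) = ∑' x, ENNReal.ofReal (g x) := by
  simp only [ofReal_semigroup ha h0 hg ht]
  rw [ENNReal.tsum_comm]
  simp only [ENNReal.tsum_mul_left, tsum_wavg]
  simp only [← mul_assoc, ENNReal.tsum_mul_right]
  rw [tsum_poisson ha h0 ht, one_mul]

theorem semigroup_le {g : BddSeq} (hg : ∀ x, 0 ≤ g x) (hmono : ∀ x y : ℤ, |x| ≤ |y| → a y ≤ a x)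
    {t : ℝ} (ht : 0 ≤ t) {x : ℤ} {m₁ m₂ : ℝ}
    (h₁ : ∀ n : ℕ, ∑ i ∈ Finset.range n, g (x + i) ≤ n * m₁)
    (h₂ : ∀ n : ℕ, ∑ i ∈ Finset.range n, g (x - i) ≤ n * m₂) :
    semigroup ha t g x ≤ m₁ + m₂ := by
  have hm₁ : 0 ≤ m₁ := (hg x).trans (by simpa using h₁ 1)
  have hm₂ : 0 ≤ m₂ := (hg x).trans (by simpa using h₂ 1)
  have hk : ∀ n, SymmUnimodal (kpow a n) := fun n => by
    induction n with
    | zero => exact symmUnimodal_single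
    | succ n ih =>
      exact SymmUnimodal.conv (fun x y h => ENNReal.ofReal_le_ofReal (hmono x y h)) ih
  have hk0 : ∀ n, kpow a n 0 ≠ ∞ := fun n => by
    refine ne_top_of_le_ne_top ?_ (ENNReal.le_tsum (f := kpow a n) 0)
    rw [tsum_kpow ha h0]
    exact ENNReal.pow_ne_top ENNReal.ofReal_ne_top
  have hsum : ∀ (φ : ℕ → ℤ) {m : ℝ} (n : ℕ), ∑ i ∈ Finset.range n, g (φ i) ≤ n * m →
      ∑ i ∈ Finset.range n, ENNReal.ofReal (g (φ i)) ≤ n * ENNReal.ofReal m := fun φ m n h => by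
    rw [← ENNReal.ofReal_sum_of_nonneg fun i _ => hg _, ← ENNReal.ofReal_natCast,
      ← ENNReal.ofReal_mul (Nat.cast_nonneg _)]
    exact ENNReal.ofReal_le_ofReal h
  rw [← ENNReal.ofReal_le_ofReal_iff (add_nonneg hm₁ hm₂), ofReal_semigroup ha h0 hg ht,
    ENNReal.ofReal_add hm₁ hm₂]
  calc _ ≤ ∑' n : ℕ, ENNReal.ofReal (Real.exp (-(t * ∑' z, a z)) * (t ^ n / (n.factorial : ℝ))) *
        ((∑' z, kpow a n z) * (ENNReal.ofReal m₁ + ENNReal.ofReal m₂)) :=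
        ENNReal.tsum_le_tsum fun n => mul_le_mul_right ((hk n).wavg_le (hk0 n)
          ENNReal.ofReal_ne_top ENNReal.ofReal_ne_top (fun n => hsum _ n (h₁ n))
          fun n => hsum _ n (h₂ n)) _
    _ = _ := by
        simp only [← mul_assoc, ENNReal.tsum_mul_right]
        rw [tsum_poisson ha h0 ht, one_mul]

end Semigroup

section Energy

open scoped ENNReal

variable {a : ℤ → ℝ}

/-- The weighted sum of the Bregman divergences of `r ↦ r ^ q` between `u x` and its translates. -/
noncomputable def bregman (a : ℤ → ℝ) (q : ℝ) (u : ℤ → ℝ) (x : ℤ) : ℝ :=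
  ∑' z, a z * ((q - 1) * u x ^ q + u (x + z) ^ q - q * u x ^ (q - 1) * u (x + z))

theorem bregman_term_nonneg {q : ℝ} (hq : 1 < q) {b c : ℝ} (hb : 0 ≤ b) (hc : 0 ≤ c) :
    0 ≤ (q - 1) * b ^ q + c ^ q - q * b ^ (q - 1) * c := by
  have hq0 : 0 < q := by linarith
  have h := Real.geom_mean_le_arith_mean2_weighted (w₁ := (q - 1) / q) (w₂ := 1 / q)
    (div_nonneg (by linarith) hq0.le) (by positivity) (Real.rpow_nonneg hb q)
    (Real.rpow_nonneg hc q) (by field_simp; ring)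
  rw [← Real.rpow_mul hb, ← Real.rpow_mul hc, mul_div_cancel₀ _ hq0.ne',
    mul_one_div_cancel hq0.ne', Real.rpow_one] at h
  have h2 := mul_le_mul_of_nonneg_left h hq0.le
  have e : q * ((q - 1) / q * b ^ q + 1 / q * c ^ q) = (q - 1) * b ^ q + c ^ q := by
    field_simp
  linarith

theorem bregman_nonneg (h0 : ∀ z, 0 ≤ a z) {q : ℝ} (hq : 1 < q) {u : ℤ → ℝ}
    (hu : ∀ x, 0 ≤ u x) (x : ℤ) : 0 ≤ bregman a q u x :=
  tsum_nonneg fun z => mul_nonneg (h0 z) (bregman_term_nonneg hq (hu x) (hu _))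

theorem summable_mul_shift_of_bdd (ha : Summable a) {g : ℤ → ℝ} {C : ℝ} (hg : ∀ x, |g x| ≤ C)
    (x : ℤ) : Summable fun z => a z * g (x + z) :=
  summable_mul_shift ha (BddSeq.mk g C hg) x

theorem bregman_eq (ha : Summable a) {q : ℝ} {u : ℤ → ℝ} {C D : ℝ}
    (hC : ∀ x, |u x| ≤ C) (hD : ∀ x, |u x ^ q| ≤ D) (x : ℤ) :
    bregman a q u x = (q - 1) * (∑' z, a z) * u x ^ q + ∑' z, a z * u (x + z) ^ q -
      q * u x ^ (q - 1) * ∑' z, a z * u (x + z) := by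
  have h1 := (ha.mul_left ((q - 1) * u x ^ q)).hasSum
  have h2 := (summable_mul_shift_of_bdd ha hD x).hasSum
  have h3 := ((summable_mul_shift_of_bdd ha hC x).mul_left (q * u x ^ (q - 1))).hasSum
  have h := ((h1.add h2).sub h3).tsum_eq
  rw [tsum_mul_left, tsum_mul_left] at h
  rw [bregman, mul_right_comm (q - 1), ← h]
  exact tsum_congr fun z => by ring

theorem lintegral_ofReal_Ioc {h : ℝ → ℝ} {T : ℝ} (hT : 0 ≤ T) (hc : ContinuousOn h (Set.Icc 0 T))
    (hn : ∀ t ∈ Set.Icc 0 T, 0 ≤ h t) :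
    ∫⁻ t in Set.Ioc 0 T, ENNReal.ofReal (h t) = ENNReal.ofReal (∫ t in 0..T, h t) := by
  rw [intervalIntegral.integral_of_le hT, ofReal_integral_eq_lintegral_ofReal]
  · exact hc.integrableOn_Icc.mono_set Set.Ioc_subset_Icc_self
  · exact (ae_restrict_iff' measurableSet_Ioc).2
      (ae_of_all _ fun t ht => hn t (Set.Ioc_subset_Icc_self ht))

theorem aemeasurable_ofReal_Ioc {h : ℝ → ℝ} {T : ℝ} (hc : ContinuousOn h (Set.Icc 0 T)) :
    AEMeasurable (fun t => ENNReal.ofReal (h t)) (volume.restrict (Set.Ioc 0 T)) :=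
  ((hc.mono Set.Ioc_subset_Icc_self).aemeasurable measurableSet_Ioc).ennreal_ofReal

theorem continuousOn_tsum_shift (ha : Summable a) {w : ℝ → ℤ → ℝ} {S : Set ℝ} {C : ℝ}
    (hw : ∀ x, ContinuousOn (fun t => w t x) S) (hC : ∀ t ∈ S, ∀ x, |w t x| ≤ C) (x : ℤ) :
    ContinuousOn (fun t => ∑' z, a z * w t (x + z)) S := by
  refine continuousOn_tsum (fun z => continuousOn_const.mul (hw _)) (ha.norm.mul_right C)
    fun z t ht => ?_
  rw [norm_mul]
  exact mul_le_mul_of_nonneg_left (hC t ht _) (norm_nonneg _)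

theorem semigroup_zero (ha : Summable a) (g : BddSeq) (x : ℤ) : semigroup ha 0 g x = g x := by
  have h : semigroup ha 0 = 1 := by
    rw [semigroup, zero_smul ℝ (-genOp ha), NormedSpace.exp_zero]
  rw [h]
  rfl

theorem semigroup_le_tsum (ha : Summable a) (h0 : ∀ z, 0 ≤ a z) {g : BddSeq}
    (hg : ∀ x, 0 ≤ g x) (hgs : Summable fun x => g x) {t : ℝ} (ht : 0 ≤ t) (x : ℤ) :
    semigroup ha t g x ≤ ∑' x, g x := by
  rw [← ENNReal.ofReal_le_ofReal_iff (tsum_nonneg hg), ENNReal.ofReal_tsum_of_nonneg hg hgs,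
    ← tsum_ofReal_semigroup ha h0 hg ht]
  exact ENNReal.le_tsum (f := fun x => ENNReal.ofReal (semigroup ha t g x)) x

theorem semigroup_rpow_le (ha : Summable a) (h0 : ∀ z, 0 ≤ a z) {q : ℝ} (hq : 1 < q) {g : BddSeq}
    (hg : ∀ x, 0 ≤ g x) (hgs : Summable fun x => g x) {t : ℝ} (ht : 0 ≤ t) (x : ℤ) :
    |semigroup ha t g x ^ q| ≤ (∑' x, g x) ^ q := by
  rw [abs_of_nonneg (Real.rpow_nonneg (semigroup_nonneg ha h0 hg ht x) q)]
  exact Real.rpow_le_rpow (semigroup_nonneg ha h0 hg ht x)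
    (semigroup_le_tsum ha h0 hg hgs ht x) (by linarith)

theorem continuous_semigroup_apply (ha : Summable a) (g : BddSeq) (x : ℤ) :
    Continuous fun t => semigroup ha t g x :=
  continuous_iff_continuousAt.2 fun t => (hasDerivAt_semigroup ha g x t).continuousAt

theorem continuous_semigroup_rpow (ha : Summable a) {q : ℝ} (hq : 1 < q) (g : BddSeq) (x : ℤ) :
    Continuous fun t => semigroup ha t g x ^ q :=
  (continuous_semigroup_apply ha g x).rpow_const fun _ => Or.inr (by linarith)

theorem continuousOn_tsum_rpow (ha : Summable a) (h0 : ∀ z, 0 ≤ a z) {q : ℝ} (hq : 1 < q)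
    {g : BddSeq} (hg : ∀ x, 0 ≤ g x) (hgs : Summable fun x => g x) (T : ℝ) (x : ℤ) :
    ContinuousOn (fun t => ∑' z, a z * semigroup ha t g (x + z) ^ q) (Set.Icc 0 T) :=
  continuousOn_tsum_shift ha (fun y => (continuous_semigroup_rpow ha hq g y).continuousOn)
    (fun _ ht => semigroup_rpow_le ha h0 hq hg hgs ht.1) x

theorem integral_balance (ha : Summable a) (h0 : ∀ z, 0 ≤ a z) {q : ℝ} (hq : 1 < q) {g : BddSeq}
    (hg : ∀ x, 0 ≤ g x) (hgs : Summable fun x => g x) {T : ℝ} (hT : 0 ≤ T) (x : ℤ) :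
    (∫⁻ t in Set.Ioc 0 T, ENNReal.ofReal (bregman a q (semigroup ha t g) x)) +
      ENNReal.ofReal (∑' z, a z) * (∫⁻ t in Set.Ioc 0 T, ENNReal.ofReal (semigroup ha t g x ^ q)) +
      ENNReal.ofReal (semigroup ha T g x ^ q) =
    ENNReal.ofReal (g x ^ q) +
      ∫⁻ t in Set.Ioc 0 T, ENNReal.ofReal (∑' z, a z * semigroup ha t g (x + z) ^ q) := by
  set c := ∑' z, a z with hcdef
  have hc0 : 0 ≤ c := tsum_nonneg h0
  set u : ℝ → ℤ → ℝ := fun t => semigroup ha t g with hu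
  have hu0 : ∀ t ∈ Set.Icc 0 T, ∀ y, 0 ≤ u t y := fun t ht => semigroup_nonneg ha h0 hg ht.1
  have huB : ∀ t ∈ Set.Icc 0 T, ∀ y, |u t y| ≤ ∑' x, g x := fun t ht y => by
    rw [abs_of_nonneg (hu0 t ht y)]
    exact semigroup_le_tsum ha h0 hg hgs ht.1 y
  have hucont : ∀ y, Continuous fun t => u t y := continuous_semigroup_apply ha g
  have hv : ContinuousOn (fun t => u t x ^ q) (Set.Icc 0 T) :=
    (continuous_semigroup_rpow ha hq g x).continuousOn
  have hAv : ContinuousOn (fun t => ∑' z, a z * u t (x + z) ^ q) (Set.Icc 0 T) :=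
    continuousOn_tsum_rpow ha h0 hq hg hgs T x
  have hAu : ContinuousOn (fun t => ∑' z, a z * u t (x + z)) (Set.Icc 0 T) :=
    continuousOn_tsum_shift ha (fun y => (hucont y).continuousOn) huB x
  have hw : ContinuousOn (fun t => u t x ^ (q - 1)) (Set.Icc 0 T) :=
    ((hucont x).rpow_const fun _ => Or.inr (by linarith)).continuousOn
  have hDeq : ∀ t ∈ Set.Icc 0 T, bregman a q (u t) x = (q - 1) * c * u t x ^ q +
      ∑' z, a z * u t (x + z) ^ q - q * u t x ^ (q - 1) * ∑' z, a z * u t (x + z) :=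
    fun t ht => bregman_eq ha (huB t ht) (semigroup_rpow_le ha h0 hq hg hgs ht.1) x
  have hD : ContinuousOn (fun t => bregman a q (u t) x) (Set.Icc 0 T) :=
    (((continuousOn_const.mul hv).add hAv).sub ((continuousOn_const.mul hw).mul hAu)).congr hDeq
  have hv0 : ∀ t ∈ Set.Icc 0 T, ∀ y, 0 ≤ u t y ^ q := fun t ht y => Real.rpow_nonneg (hu0 t ht y) q
  have hint : ∀ {h : ℝ → ℝ}, ContinuousOn h (Set.Icc 0 T) → IntervalIntegrable h volume 0 T :=
    fun h => h.intervalIntegrable_of_Icc hT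
  have hFTC : ∫ t in 0..T, (∑' z, a z * u t (x + z) ^ q - bregman a q (u t) x - c * u t x ^ q) =
      u T x ^ q - g x ^ q := by
    rw [← semigroup_zero ha g x]
    refine intervalIntegral.integral_eq_sub_of_hasDerivAt (f := fun t => u t x ^ q)
      (fun t ht => ?_) (hint ((hAv.sub hD).sub (continuousOn_const.mul hv)))
    rw [Set.uIcc_of_le hT] at ht
    have hd := (hasDerivAt_semigroup ha g x t).rpow_const (p := q) (Or.inr hq.le)
    refine hd.congr_deriv ?_
    have hpow : u t x ^ q = u t x ^ (q - 1) * u t x := by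
      rw [← Real.rpow_add_one' (hu0 t ht x) (by linarith), sub_add_cancel]
    change -(c * u t x - ∑' z, a z * u t (x + z)) * q * u t x ^ (q - 1) = _
    rw [hDeq t ht, hpow]
    ring
  rw [intervalIntegral.integral_sub ((hint hAv).sub (hint hD)) ((hint hv).const_mul c),
    intervalIntegral.integral_sub (hint hAv) (hint hD), intervalIntegral.integral_const_mul] at hFTC
  have nonneg : ∀ {h : ℝ → ℝ}, (∀ t ∈ Set.Icc 0 T, 0 ≤ h t) → 0 ≤ ∫ t in 0..T, h t :=
    fun h => intervalIntegral.integral_nonneg hT h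
  have hD0 : ∀ t ∈ Set.Icc 0 T, 0 ≤ bregman a q (u t) x :=
    fun t ht => bregman_nonneg h0 hq (hu0 t ht) x
  have hAv0 : ∀ t ∈ Set.Icc 0 T, 0 ≤ ∑' z, a z * u t (x + z) ^ q :=
    fun t ht => tsum_nonneg fun z => mul_nonneg (h0 z) (hv0 t ht _)
  have hvx : ∀ t ∈ Set.Icc 0 T, 0 ≤ u t x ^ q := fun t ht => hv0 t ht x
  change (∫⁻ t in Set.Ioc 0 T, ENNReal.ofReal (bregman a q (u t) x)) +
      ENNReal.ofReal c * (∫⁻ t in Set.Ioc 0 T, ENNReal.ofReal (u t x ^ q)) +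
      ENNReal.ofReal (u T x ^ q) = ENNReal.ofReal (g x ^ q) +
      ∫⁻ t in Set.Ioc 0 T, ENNReal.ofReal (∑' z, a z * u t (x + z) ^ q)
  rw [lintegral_ofReal_Ioc hT hD hD0, lintegral_ofReal_Ioc hT hv hvx,
    lintegral_ofReal_Ioc hT hAv hAv0, ← ENNReal.ofReal_mul hc0,
    ← ENNReal.ofReal_add (nonneg hD0) (mul_nonneg hc0 (nonneg hvx)),
    ← ENNReal.ofReal_add (add_nonneg (nonneg hD0) (mul_nonneg hc0 (nonneg hvx)))
      (hvx T ⟨hT, le_rfl⟩),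
    ← ENNReal.ofReal_add (Real.rpow_nonneg (hg x) q) (nonneg hAv0)]
  congr 1
  linarith

theorem tsum_ofReal_semigroup_rpow_le (ha : Summable a) (h0 : ∀ z, 0 ≤ a z) {q : ℝ} (hq : 1 < q)
    {g : BddSeq} (hg : ∀ x, 0 ≤ g x) (hgs : Summable fun x => g x) {t : ℝ} (ht : 0 ≤ t) :
    ∑' x, ENNReal.ofReal (semigroup ha t g x ^ q) ≤
      ENNReal.ofReal ((∑' x, g x) ^ (q - 1)) * ENNReal.ofReal (∑' x, g x) := by
  rw [ENNReal.ofReal_tsum_of_nonneg hg hgs, ← tsum_ofReal_semigroup ha h0 hg ht,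
    ← ENNReal.tsum_mul_left]
  refine ENNReal.tsum_le_tsum fun x => ?_
  have hu := semigroup_nonneg ha h0 hg ht x
  rw [← ENNReal.ofReal_mul (Real.rpow_nonneg (tsum_nonneg hg) _)]
  refine ENNReal.ofReal_le_ofReal ?_
  calc semigroup ha t g x ^ q = semigroup ha t g x ^ (q - 1) * semigroup ha t g x := by
        rw [← Real.rpow_add_one' hu (by linarith), sub_add_cancel]
    _ ≤ _ := mul_le_mul_of_nonneg_right (Real.rpow_le_rpow hu
        (semigroup_le_tsum ha h0 hg hgs ht x) (by linarith)) hu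

theorem tsum_lintegral_bregman_le (ha : Summable a) {q : ℝ} (hq : 1 < q) (h0 : ∀ z, 0 ≤ a z)
    {g : BddSeq} (hg : ∀ x, 0 ≤ g x) (hgs : Summable fun x => g x) {T : ℝ} (hT : 0 ≤ T) :
    ∑' x, ∫⁻ t in Set.Ioc 0 T, ENNReal.ofReal (bregman a q (semigroup ha t g) x) ≤
      ∑' x, ENNReal.ofReal (g x ^ q) := by
  set V := ∑' x, ∫⁻ t in Set.Ioc 0 T, ENNReal.ofReal (semigroup ha t g x ^ q) with hV
  have hVeq : V = ∫⁻ t in Set.Ioc 0 T, ∑' x, ENNReal.ofReal (semigroup ha t g x ^ q) :=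
    (lintegral_tsum fun x =>
      aemeasurable_ofReal_Ioc (continuous_semigroup_rpow ha hq g x).continuousOn).symm
  have hVtop : V ≠ ∞ := by
    rw [hVeq]
    refine ne_top_of_le_ne_top ?_ (setLIntegral_mono' measurableSet_Ioc fun t ht =>
      tsum_ofReal_semigroup_rpow_le ha h0 hq hg hgs ht.1.le)
    rw [setLIntegral_const, Real.volume_Ioc]
    exact ENNReal.mul_ne_top (ENNReal.mul_ne_top ENNReal.ofReal_ne_top ENNReal.ofReal_ne_top)
      ENNReal.ofReal_ne_top
  have hA : ∑' x, ∫⁻ t in Set.Ioc 0 T, ENNReal.ofReal (∑' z, a z * semigroup ha t g (x + z) ^ q) =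
      ENNReal.ofReal (∑' z, a z) * V := by
    rw [← lintegral_tsum fun x =>
      aemeasurable_ofReal_Ioc (continuousOn_tsum_rpow ha h0 hq hg hgs T x), hVeq,
      ← lintegral_const_mul' _ _ ENNReal.ofReal_ne_top]
    refine setLIntegral_congr_fun measurableSet_Ioc fun t ht => ?_
    have hu := semigroup_nonneg ha h0 hg ht.1.le
    simp only
    rw [ENNReal.ofReal_tsum_of_nonneg h0 ha, ← tsum_wavg]
    refine tsum_congr fun x => ?_
    rw [ENNReal.ofReal_tsum_of_nonneg
      (fun z => mul_nonneg (h0 z) (Real.rpow_nonneg (hu _) q))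
      (summable_mul_shift_of_bdd ha (semigroup_rpow_le ha h0 hq hg hgs ht.1.le) x)]
    exact tsum_congr fun z => ENNReal.ofReal_mul (h0 z)
  have hsum := congrArg (fun F : ℤ → ℝ≥0∞ => ∑' x, F x)
    (funext fun x => integral_balance ha h0 hq hg hgs hT x)
  simp only at hsum
  rw [ENNReal.tsum_add, ENNReal.tsum_add, ENNReal.tsum_add, ENNReal.tsum_mul_left, ← hV, hA] at hsum
  have hfin : ENNReal.ofReal (∑' z, a z) * V ≠ ∞ := ENNReal.mul_ne_top ENNReal.ofReal_ne_top hVtop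
  rw [← ENNReal.add_le_add_iff_right hfin, ← hsum]
  exact le_self_add

theorem tsum_lintegral_Ioi_bregman_le (ha : Summable a) {q : ℝ} (hq : 1 < q) (h0 : ∀ z, 0 ≤ a z)
    {g : BddSeq} (hg : ∀ x, 0 ≤ g x) (hgs : Summable fun x => g x) :
    ∑' x, ∫⁻ t in Set.Ioi 0, ENNReal.ofReal (bregman a q (semigroup ha t g) x) ≤
      ∑' x, ENNReal.ofReal (g x ^ q) := by
  have hU : Set.Ioi (0 : ℝ) = ⋃ n : ℕ, Set.Ioc 0 (n : ℝ) := by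
    ext t
    simp only [Set.mem_Ioi, Set.mem_iUnion, Set.mem_Ioc]
    exact ⟨fun h => (exists_nat_ge t).imp fun n hn => ⟨h, hn⟩, fun ⟨_, h, _⟩ => h⟩
  have hmono : Monotone fun n : ℕ => Set.Ioc 0 (n : ℝ) :=
    fun m n h => Set.Ioc_subset_Ioc_right (Nat.cast_le.2 h)
  simp only [hU, setLIntegral_iUnion_of_directed _ hmono.directed_le]
  rw [ENNReal.tsum_eq_iSup_sum]
  refine iSup_le fun E => ?_
  rw [ENNReal.finsetSum_iSup_of_monotone fun x m n h => lintegral_mono_set (hmono h)]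
  exact iSup_le fun n => (ENNReal.sum_le_tsum E).trans
    (tsum_lintegral_bregman_le ha hq h0 hg hgs n.cast_nonneg)

end Energy

section Bridge

open scoped ENNReal

variable {s : ℝ} (hs : s ∈ Set.Ioo (0 : ℝ) 1)

theorem Lop_eq_genOp (g : BddSeq) (x : ℤ) :
    Lop s g x = genOp (uniKer_summable hs) g x := by
  have ha := uniKer_summable hs
  rw [genOp_apply, ← tsum_mul_right, ← (ha.mul_right (g x)).tsum_sub (summable_mul_shift ha g x),
    Lop, ← (Equiv.addLeft x).tsum_eq]
  refine tsum_congr fun z => ?_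
  rw [Equiv.coe_addLeft, sub_add_cancel_left, Ker_neg]
  rcases eq_or_ne z 0 with rfl | hz
  · simp
  · rw [uniKer, if_neg hz]
    ring

theorem Lop_iterate_eq (g : BddSeq) (n : ℕ) :
    (Lop s)^[n] g = ((genOp (uniKer_summable hs)) ^ n) g := by
  induction n with
  | zero => rfl
  | succ n ih =>
    rw [Function.iterate_succ_apply', ih, pow_succ', mul_apply_eq_comp]
    exact funext (Lop_eq_genOp hs _)

theorem heat_eq_semigroup (t : ℝ) (g : BddSeq) :
    heat s t g = semigroup (uniKer_summable hs) t g := by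
  funext x
  have h := hasSum_exp_smul_apply (genOp (uniKer_summable hs)) (-t) g
    (lp.evalCLM ℝ (fun _ : ℤ => ℝ) ∞ x)
  have e : (-t) • genOp (uniKer_summable hs) = t • (-genOp (uniKer_summable hs)) := by module
  rw [e] at h
  exact (tsum_congr fun n => congrArg _ (congrFun (Lop_iterate_eq hs g n) x)).trans h.tsum_eq

include hs in
theorem GammaQ_eq {q : ℝ} (hq : q ∈ Set.Ioc (1 : ℝ) 2) {u : ℤ → ℝ} {C D : ℝ} (h0 : ∀ x, 0 ≤ u x)
    (hC : ∀ x, |u x| ≤ C) (hD : ∀ x, |u x ^ q| ≤ D) (x : ℤ) :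
    GammaQ s q u x = u x ^ (2 - q) * bregman (uniKer s) q u x := by
  have e₁ := Lop_eq_genOp hs (BddSeq.mk u C hC) x
  have e₂ := Lop_eq_genOp hs (BddSeq.mk (fun y => u y ^ q) D hD) x
  rw [genOp_apply] at e₁ e₂
  simp only [BddSeq.mk] at e₁ e₂
  have p₁ : u x ^ (2 - q) * u x ^ (q - 1) = u x := by
    rw [← Real.rpow_add' (h0 x) (by norm_num), show 2 - q + (q - 1) = 1 by ring, Real.rpow_one]
  have p₂ : u x ^ q = u x ^ (q - 1) * u x := by
    rw [← Real.rpow_add_one' (h0 x) (by linarith [hq.1]), sub_add_cancel]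
  rw [GammaQ, e₁, e₂, bregman_eq (uniKer_summable hs) hC hD, p₂]
  linear_combination (q * (∑' z, uniKer s z * u (x + z)) - q * (∑' z, uniKer s z) * u x) * p₁

theorem ofReal_integral_le_lintegral {α : Type*} [MeasurableSpace α] {μ : Measure α} {h : α → ℝ}
    (h0 : 0 ≤ᵐ[μ] h) : ENNReal.ofReal (∫ x, h x ∂μ) ≤ ∫⁻ x, ENNReal.ofReal (h x) ∂μ := by
  by_cases hi : Integrable h μ
  · exact (ofReal_integral_eq_lintegral_ofReal hi h0).le
  · rw [integral_undef hi, ENNReal.ofReal_zero]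
    exact zero_le

theorem ofReal_integral_GammaQ_le {q : ℝ} (hq : q ∈ Set.Ioc (1 : ℝ) 2) {g : BddSeq}
    (hg : ∀ x, 0 ≤ g x) (hgs : Summable fun x => g x) {x : ℤ} {m : ℝ}
    (hm : ∀ t : ℝ, 0 ≤ t → semigroup (uniKer_summable hs) t g x ≤ m) :
    ENNReal.ofReal (∫ t in Set.Ioi (0 : ℝ), GammaQ s q (heat s t g) x) ≤
      ENNReal.ofReal (m ^ (2 - q)) * ∫⁻ t in Set.Ioi (0 : ℝ),
        ENNReal.ofReal (bregman (uniKer s) q (semigroup (uniKer_summable hs) t g) x) := by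
  have ha := uniKer_summable hs
  have hu := fun t (ht : t ∈ Set.Ioi (0 : ℝ)) =>
    semigroup_nonneg ha (uniKer_nonneg hs) hg (le_of_lt ht)
  have hB := fun t (ht : t ∈ Set.Ioi (0 : ℝ)) => bregman_nonneg (uniKer_nonneg hs) hq.1 (hu t ht) x
  have hG : ∀ t ∈ Set.Ioi (0 : ℝ), GammaQ s q (heat s t g) x =
      semigroup ha t g x ^ (2 - q) * bregman (uniKer s) q (semigroup ha t g) x := fun t ht => by
    rw [heat_eq_semigroup hs]
    exact GammaQ_eq hs hq (hu t ht) (BddSeq.abs_apply_le _)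
      (semigroup_rpow_le ha (uniKer_nonneg hs) hq.1 hg hgs (le_of_lt ht)) x
  rw [← lintegral_const_mul' _ _ ENNReal.ofReal_ne_top]
  refine (ofReal_integral_le_lintegral ((ae_restrict_iff' measurableSet_Ioi).2
    (ae_of_all _ fun t ht => ?_))).trans (setLIntegral_mono' measurableSet_Ioi fun t ht => ?_)
  · rw [hG t ht]
    exact mul_nonneg (Real.rpow_nonneg (hu t ht x) _) (hB t ht)
  · rw [hG t ht, ← ENNReal.ofReal_mul
      (Real.rpow_nonneg ((hu t ht x).trans (hm t (le_of_lt ht))) _)]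
    exact ENNReal.ofReal_le_ofReal (mul_le_mul_of_nonneg_right (Real.rpow_le_rpow (hu t ht x)
      (hm t (le_of_lt ht)) (by linarith [hq.2])) (hB t ht))

theorem sqrt_rpow_le_add {q m j I : ℝ} (hq : q ∈ Set.Ioc (1 : ℝ) 2) (hm : 0 ≤ m) (hj : 0 ≤ j)
    (hI : I ≤ m ^ (2 - q) * j) : Real.sqrt I ^ q ≤ m ^ q + j := by
  have hq0 : 0 ≤ q / 2 := by linarith [hq.1]
  have hq2 : 0 ≤ 1 - q / 2 := by linarith [hq.2]
  have hmq := Real.rpow_nonneg hm q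
  have hmj := mul_nonneg (Real.rpow_nonneg hm (2 - q)) hj
  calc Real.sqrt I ^ q ≤ Real.sqrt (m ^ (2 - q) * j) ^ q :=
        Real.rpow_le_rpow (Real.sqrt_nonneg _) (Real.sqrt_le_sqrt hI) (by linarith)
    _ = (m ^ q) ^ (1 - q / 2) * j ^ (q / 2) := by
        rw [Real.sqrt_eq_rpow, ← Real.rpow_mul hmj, Real.mul_rpow (Real.rpow_nonneg hm _) hj,
          ← Real.rpow_mul hm, ← Real.rpow_mul hm]
        ring_nf
    _ ≤ (1 - q / 2) * m ^ q + q / 2 * j :=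
        Real.geom_mean_le_arith_mean2_weighted hq2 hq0 hmq hj (by ring)
    _ ≤ m ^ q + j := add_le_add (mul_le_of_le_one_left hmq (by linarith))
        (mul_le_of_le_one_left hj (by linarith [hq.2]))

end Bridge

section Assembly

open scoped ENNReal

theorem tsum_ofReal_maxAvg_add_rpow_le {q : ℝ} (hq : 1 < q) {f : ℤ → ℝ} (h0 : ∀ x, 0 ≤ f x) :
    ∑' x, ENNReal.ofReal ((maxAvg f x + maxAvg (fun y => f (-y)) (-x)) ^ q) ≤
      2 ^ (q - 1) * (2 * (ENNReal.ofReal q * ENNReal.ofReal (2 ^ q / (q - 1)))) *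
        ∑' x, ENNReal.ofReal (f x ^ q) := by
  have hq0 : 0 ≤ q := by linarith
  have h₁ := tsum_maxAvg_rpow_le hq h0
  have h₂ : ∑' x, ENNReal.ofReal (maxAvg (fun y => f (-y)) (-x) ^ q) ≤
      ENNReal.ofReal q * ENNReal.ofReal (2 ^ q / (q - 1)) * ∑' x, ENNReal.ofReal (f x ^ q) := by
    have h := tsum_maxAvg_rpow_le hq fun x => h0 (-x)
    rw [← (Equiv.neg ℤ).tsum_eq, ← (Equiv.neg ℤ).tsum_eq fun x => ENNReal.ofReal (f (-x) ^ q)] at h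
    simpa only [Equiv.neg_apply, neg_neg] using h
  have h : ∀ x, ENNReal.ofReal ((maxAvg f x + maxAvg (fun y => f (-y)) (-x)) ^ q) ≤
      2 ^ (q - 1) * (ENNReal.ofReal (maxAvg f x ^ q) +
        ENNReal.ofReal (maxAvg (fun y => f (-y)) (-x) ^ q)) := fun x => by
    have n₁ := maxAvg_nonneg h0 x
    have n₂ := maxAvg_nonneg (fun y => h0 (-y)) (-x)
    rw [← ENNReal.ofReal_rpow_of_nonneg (add_nonneg n₁ n₂) hq0, ENNReal.ofReal_add n₁ n₂,
      ← ENNReal.ofReal_rpow_of_nonneg n₁ hq0, ← ENNReal.ofReal_rpow_of_nonneg n₂ hq0]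
    exact ENNReal.rpow_add_le_mul_rpow_add_rpow _ _ hq.le
  refine (ENNReal.tsum_le_tsum h).trans ?_
  rw [ENNReal.tsum_mul_left, ENNReal.tsum_add, mul_assoc, mul_assoc 2, two_mul]
  gcongr

theorem semigroup_le_maxAvg {s : ℝ} (hs : s ∈ Set.Ioo (0 : ℝ) 1) {g : BddSeq}
    (hg : ∀ x, 0 ≤ g x) (hgs : Summable fun x => g x) {t : ℝ} (ht : 0 ≤ t) (x : ℤ) :
    semigroup (uniKer_summable hs) t g x ≤ maxAvg g x + maxAvg (fun y => g (-y)) (-x) := by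
  refine semigroup_le _ (uniKer_nonneg hs) hg (fun _ _ => uniKer_le hs) ht
    (sum_range_le_mul_maxAvg hgs hg x) fun n => ?_
  have h := sum_range_le_mul_maxAvg ((Equiv.neg ℤ).summable_iff.2 hgs) (fun y => hg (-y)) (-x) n
  simp only [Function.comp_def, Equiv.neg_apply, neg_add, neg_neg, ← sub_eq_add_neg] at h
  exact h

theorem tsum_ofReal_sqrt_rpow_le {s q : ℝ} (hs : s ∈ Set.Ioo (0 : ℝ) 1)
    (hq : q ∈ Set.Ioc (1 : ℝ) 2) {g : BddSeq} (hg : ∀ x, 0 ≤ g x) (hgs : Summable fun x => g x)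
    (hfin : ∑' x, ENNReal.ofReal (g x ^ q) ≠ ∞) :
    ∑' x, ENNReal.ofReal (Real.sqrt (∫ t in Set.Ioi (0 : ℝ), GammaQ s q (heat s t g) x) ^ q) ≤
      (2 ^ (q - 1) * (2 * (ENNReal.ofReal q * ENNReal.ofReal (2 ^ q / (q - 1)))) + 1) *
        ∑' x, ENNReal.ofReal (g x ^ q) := by
  have ha := uniKer_summable hs
  set J : ℤ → ℝ≥0∞ := fun x => ∫⁻ t in Set.Ioi (0 : ℝ),
    ENNReal.ofReal (bregman (uniKer s) q (semigroup ha t g) x) with hJ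
  have hJle : ∑' x, J x ≤ ∑' x, ENNReal.ofReal (g x ^ q) :=
    tsum_lintegral_Ioi_bregman_le ha hq.1 (uniKer_nonneg hs) hg hgs
  have hJtop : ∀ x, J x ≠ ∞ := ENNReal.ne_top_of_tsum_ne_top (ne_top_of_le_ne_top hfin hJle)
  have h : ∀ x, ENNReal.ofReal
      (Real.sqrt (∫ t in Set.Ioi (0 : ℝ), GammaQ s q (heat s t g) x) ^ q) ≤
      ENNReal.ofReal ((maxAvg g x + maxAvg (fun y => g (-y)) (-x)) ^ q) + J x := fun x => by
    have hm := add_nonneg (maxAvg_nonneg hg x) (maxAvg_nonneg (fun y => hg (-y)) (-x))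
    have hI := ofReal_integral_GammaQ_le hs hq hg hgs
      fun t ht => semigroup_le_maxAvg hs hg hgs ht x
    rw [← ENNReal.ofReal_toReal (hJtop x), ← ENNReal.ofReal_add (Real.rpow_nonneg hm q)
      ENNReal.toReal_nonneg]
    refine ENNReal.ofReal_le_ofReal (sqrt_rpow_le_add hq hm ENNReal.toReal_nonneg ?_)
    rw [← ENNReal.ofReal_le_ofReal_iff (mul_nonneg (Real.rpow_nonneg hm _) ENNReal.toReal_nonneg),
      ENNReal.ofReal_mul (Real.rpow_nonneg hm _), ENNReal.ofReal_toReal (hJtop x)]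
    exact hI
  refine (ENNReal.tsum_le_tsum h).trans ?_
  rw [ENNReal.tsum_add, add_mul, one_mul]
  exact add_le_add (tsum_ofReal_maxAvg_add_rpow_le hq.1 hg) hJle

theorem summable_rpow_of_summable {f : ℤ → ℝ} (hf : Summable f) (h0 : ∀ x, 0 ≤ f x) {q : ℝ}
    (hq : 1 < q) : Summable fun x => f x ^ q := by
  refine Summable.of_nonneg_of_le (fun x => Real.rpow_nonneg (h0 x) q) (fun x => ?_)
    (hf.mul_left ((∑' x, f x) ^ (q - 1)))
  calc f x ^ q = f x ^ (q - 1) * f x := by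
        rw [← Real.rpow_add_one' (h0 x) (by linarith), sub_add_cancel]
    _ ≤ _ := mul_le_mul_of_nonneg_right (Real.rpow_le_rpow (h0 x)
        (hf.le_tsum x fun y _ => h0 y) (by linarith)) (h0 x)

theorem tsum_le_of_tsum_ofReal_le {ι : Type*} {F : ι → ℝ} (h0 : ∀ i, 0 ≤ F i) {b : ℝ} (hb : 0 ≤ b)
    (h : ∑' i, ENNReal.ofReal (F i) ≤ ENNReal.ofReal b) : ∑' i, F i ≤ b := by
  by_cases hF : Summable F
  · rwa [← ENNReal.ofReal_le_ofReal_iff hb, ENNReal.ofReal_tsum_of_nonneg h0 hF]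
  · rwa [tsum_eq_zero_of_not_summable hF]

end Assembly

/-- For every `q ∈ (1,2]` there is `c_q > 0`, depending only on `q`, such that for every
`s ∈ (0,1)` and every summable nonnegative `f`, `‖H_q f‖_q ≤ c_q ‖f‖_q`, where
`H_q f x = (∫₀^∞ Γ_q (P_t f)(x) dt)^{1/2}`. -/
theorem lq_bound_Hq (q : ℝ) (hq : q ∈ Set.Ioc (1 : ℝ) 2) :
    ∃ c : ℝ, 0 < c ∧ ∀ s : ℝ, s ∈ Set.Ioo (0 : ℝ) 1 →
      ∀ f : ℤ → ℝ, Summable f → (∀ x, 0 ≤ f x) →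
        lqNorm q (fun x => Real.sqrt (∫ t in Set.Ioi (0 : ℝ), GammaQ s q (heat s t f) x)) ≤
          c * lqNorm q f := by
  set K : ENNReal :=
    2 ^ (q - 1) * (2 * (ENNReal.ofReal q * ENNReal.ofReal (2 ^ q / (q - 1)))) + 1 with hK
  have hKtop : K ≠ ⊤ := by
    have h2 : (2 : ENNReal) ^ (q - 1) ≠ ⊤ :=
      ENNReal.rpow_ne_top_of_nonneg (by linarith [hq.1]) ENNReal.ofNat_ne_top
    exact ENNReal.add_ne_top.2 ⟨ENNReal.mul_ne_top h2 (ENNReal.mul_ne_top ENNReal.ofNat_ne_top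
      (ENNReal.mul_ne_top ENNReal.ofReal_ne_top ENNReal.ofReal_ne_top)), ENNReal.one_ne_top⟩
  have hKpos : 0 < K.toReal := ENNReal.toReal_pos (by simp [hK]) hKtop
  refine ⟨K.toReal ^ (1 / q), Real.rpow_pos_of_pos hKpos _, fun s hs f hf h0 => ?_⟩
  have hfq := summable_rpow_of_summable hf h0 hq.1
  have hfq0 : ∀ x, 0 ≤ f x ^ q := fun x => Real.rpow_nonneg (h0 x) q
  have hsum := ENNReal.ofReal_tsum_of_nonneg hfq0 hfq
  have key := tsum_ofReal_sqrt_rpow_le hs hq (g := BddSeq.mk f (∑' x, f x) fun x => by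
    rw [abs_of_nonneg (h0 x)]
    exact hf.le_tsum x fun y _ => h0 y) h0 hf (hsum ▸ ENNReal.ofReal_ne_top)
  simp only [BddSeq.mk] at key
  rw [← hK, ← hsum, ← ENNReal.ofReal_toReal hKtop, ← ENNReal.ofReal_mul hKpos.le] at key
  simp only [lqNorm, abs_of_nonneg (Real.sqrt_nonneg _), abs_of_nonneg (h0 _)]
  rw [← Real.mul_rpow hKpos.le (tsum_nonneg hfq0)]
  exact Real.rpow_le_rpow (tsum_nonneg fun x => Real.rpow_nonneg (Real.sqrt_nonneg _) q)
    (tsum_le_of_tsum_ofReal_le (fun x => Real.rpow_nonneg (Real.sqrt_nonneg _) q)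
      (mul_nonneg hKpos.le (tsum_nonneg hfq0)) key) (one_div_nonneg.2 (by linarith [hq.1]))
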